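/- Let S be a C-semigroup in ℕ^d with a term order ≺ on ℕ^d. If S is ≺-almost symmetric, then: (a) Ω_≺ = S ∪ PF'_≺(S); (b) Ω_≺ + S* = S*, where S* = S \ {0}; (c) Ω_≺ ⊆ S − S*; and (d) |PF(S)| = |Ω_≺ \ S| + 1. -/

import Mathlib

open Set

/-- Membership in the rational cone spanned by `S` inside `ℚ^d`. -/
def memCone {d : ℕ} (S : Set (Fin d → ℕ)) (x : Fin d → ℚ) : Prop :=
  ∃ (n : ℕ) (c : Fin n → ℚ) (v : Fin n → (Fin d → ℕ)),
    (∀ i, 0 ≤ c i) ∧ (∀ i, v i ∈ S) ∧ x = ∑ i, c i • (fun j => ((v i j : ℚ)))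

/-- `cone(S) ∩ ℕ^d`, viewed as a subset of `ℕ^d`. -/
def coneN {d : ℕ} (S : Set (Fin d → ℕ)) : Set (Fin d → ℕ) :=
  {x | memCone S (fun j => ((x j : ℚ)))}

/-- `H(S) = (cone(S) \ S) ∩ ℕ^d`. -/
def Hset {d : ℕ} (S : Set (Fin d → ℕ)) : Set (Fin d → ℕ) := coneN S \ S

/-- The set of pseudo-Frobenius elements of `S`. -/
def pfSet {d : ℕ} (S : Set (Fin d → ℕ)) : Set (Fin d → ℕ) :=
  {f | f ∈ Hset S ∧ ∀ s ∈ S, s ≠ 0 → f + s ∈ S}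

/-- A term order on `ℕ^d`: a strict total order compatible with addition. -/
def IsTermOrder {d : ℕ} (prec : (Fin d → ℕ) → (Fin d → ℕ) → Prop) : Prop :=
  (∀ a, ¬ prec a a) ∧ (∀ a b c, prec a b → prec b c → prec a c) ∧
    (∀ a b, a ≠ b → prec a b ∨ prec b a) ∧
    (∀ a b c, prec a b → prec (a + c) (b + c))

/-- `F` is the maximum of `H(S)` with respect to the term order `prec`. -/
def IsFrob {d : ℕ} (S : Set (Fin d → ℕ)) (prec : (Fin d → ℕ) → (Fin d → ℕ) → Prop)
    (F : Fin d → ℕ) : Prop :=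
  F ∈ Hset S ∧ ∀ h ∈ Hset S, h ≠ F → prec h F

/-- A `C`-semigroup: a finitely generated submonoid of `ℕ^d` with
`H(S)` nonempty and finite. -/
def CSemigroup {d : ℕ} (S : AddSubmonoid (Fin d → ℕ)) : Prop :=
  S.FG ∧ (Hset (S : Set (Fin d → ℕ))).Nonempty ∧ (Hset (S : Set (Fin d → ℕ))).Finite

/-- `T` is an ideal of `S`: a subset of `cone(S) ∩ ℕ^d` with `S + T ⊆ T`. -/
def IsIdeal {d : ℕ} (S T : Set (Fin d → ℕ)) : Prop :=
  T ⊆ coneN S ∧ ∀ s ∈ S, ∀ t ∈ T, s + t ∈ T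

/-- `Ω_≺ = {z ∈ cone(S) ∩ ℕ^d : F(S)_≺ − z ∉ S}` (the condition `F − z ∉ S`
is expressed as: there is no `w ∈ S` with `z + w = F`). -/
def omegaSet {d : ℕ} (S : Set (Fin d → ℕ)) (F : Fin d → ℕ) : Set (Fin d → ℕ) :=
  {z ∈ coneN S | ¬ ∃ w ∈ S, z + w = F}

/-- `S` is `≺`-almost symmetric (with Frobenius element `F`):
`PF'(S) = PF(S) \ {F}` is nonempty and `F − g ∈ PF'(S)` for every `g ∈ PF'(S)`. -/
def AlmostSym {d : ℕ} (S : Set (Fin d → ℕ)) (F : Fin d → ℕ) : Prop :=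
  (pfSet S \ {F}).Nonempty ∧ ∀ g ∈ pfSet S \ {F}, ∃ w ∈ pfSet S \ {F}, g + w = F

/-- The unique minimal generating set of a submonoid of `ℕ^d`:
the nonzero elements that are not sums of two nonzero elements. -/
def minGens {d : ℕ} (S : Set (Fin d → ℕ)) : Set (Fin d → ℕ) :=
  {s ∈ S | s ≠ 0 ∧ ¬ ∃ x ∈ S, ∃ y ∈ S, x ≠ 0 ∧ y ≠ 0 ∧ x + y = s}

theorem memCone.add {d : ℕ} {S : Set (Fin d → ℕ)} {x y : Fin d → ℚ}
    (hx : memCone S x) (hy : memCone S y) : memCone S (x + y) := by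
  obtain ⟨n, c, v, hc, hv, rfl⟩ := hx
  obtain ⟨m, c', v', hc', hv', rfl⟩ := hy
  refine ⟨n + m, Fin.append c c', Fin.append v v', fun i => ?_, fun i => ?_, ?_⟩
  · refine Fin.addCases (fun i => ?_) (fun i => ?_) i
    · simpa using hc i
    · simpa using hc' i
  · refine Fin.addCases (fun i => ?_) (fun i => ?_) i
    · simpa using hv i
    · simpa using hv' i
  · simp [Fin.sum_univ_add]

theorem subset_coneN {d : ℕ} (S : Set (Fin d → ℕ)) : S ⊆ coneN S := fun s hs =>
  ⟨1, fun _ => 1, fun _ => s, fun _ => zero_le_one, fun _ => hs, by simp⟩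

theorem add_mem_coneN {d : ℕ} {S : Set (Fin d → ℕ)} {x y : Fin d → ℕ}
    (hx : x ∈ coneN S) (hy : y ∈ coneN S) : x + y ∈ coneN S := by
  have h := memCone.add hx hy
  change memCone S _
  convert h using 1
  ext j
  simp

/-- Every gap lies below a pseudo-Frobenius element in the order induced by `S`. -/
theorem exists_add_mem_pfSet {d : ℕ} (S : AddSubmonoid (Fin d → ℕ))
    (hfin : (Hset (S : Set (Fin d → ℕ))).Finite) {z : Fin d → ℕ}
    (hz : z ∈ Hset (S : Set (Fin d → ℕ))) :
    ∃ s ∈ S, z + s ∈ pfSet (S : Set (Fin d → ℕ)) := by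
  let A : Set (Fin d → ℕ) := {x ∈ Hset (S : Set (Fin d → ℕ)) | ∃ s ∈ S, z + s = x}
  have hA : A.Finite := hfin.subset fun x hx => hx.1
  obtain ⟨f, ⟨hfH, s, hs, rfl⟩, hmax⟩ :=
    hA.exists_maximal ⟨z, hz, 0, S.zero_mem, add_zero z⟩
  refine ⟨s, hs, hfH, fun t ht ht0 => ?_⟩
  by_contra hn
  have hle := hmax (y := z + s + t)
    ⟨⟨add_mem_coneN hfH.1 (subset_coneN _ ht), hn⟩, s + t, S.add_mem hs ht, by rw [add_assoc]⟩
    le_self_add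
  refine ht0 (funext fun i => ?_)
  have := hle i
  simp only [Pi.add_apply] at this
  simp only [Pi.zero_apply]
  omega

theorem AlmostSym.frob_mem_pfSet {d : ℕ} {S : AddSubmonoid (Fin d → ℕ)} {F : Fin d → ℕ}
    (hAS : AlmostSym (S : Set (Fin d → ℕ)) F) (hF : F ∈ Hset (S : Set (Fin d → ℕ))) :
    F ∈ pfSet (S : Set (Fin d → ℕ)) := by
  obtain ⟨g, hg⟩ := hAS.1
  obtain ⟨w, hw, rfl⟩ := hAS.2 g hg
  refine ⟨hF, fun s hs hs0 => ?_⟩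
  rw [add_assoc]
  exact hg.1.2 _ (hw.1.2 s hs hs0) fun h => hs0 (add_eq_zero.mp h).2

theorem AlmostSym.omegaSet_eq {d : ℕ} {S : AddSubmonoid (Fin d → ℕ)} {F : Fin d → ℕ}
    (hAS : AlmostSym (S : Set (Fin d → ℕ)) F) (hF : F ∈ Hset (S : Set (Fin d → ℕ)))
    (hfin : (Hset (S : Set (Fin d → ℕ))).Finite) :
    omegaSet (S : Set (Fin d → ℕ)) F =
      (S : Set (Fin d → ℕ)) ∪ (pfSet (S : Set (Fin d → ℕ)) \ {F}) := by
  ext z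
  constructor
  · rintro ⟨hzc, hz⟩
    by_cases hzS : z ∈ (S : Set (Fin d → ℕ))
    · exact Or.inl hzS
    obtain ⟨s, hs, hf⟩ := exists_add_mem_pfSet S hfin ⟨hzc, hzS⟩
    have hne : z + s ≠ F := fun h => hz ⟨s, hs, h⟩
    rcases eq_or_ne s 0 with rfl | hs0
    · rw [add_zero] at hf hne
      exact Or.inr ⟨hf, hne⟩
    · obtain ⟨w, hw, hsum⟩ := hAS.2 _ ⟨hf, hne⟩
      refine absurd ⟨w + s, hw.1.2 s hs hs0, ?_⟩ hz
      rw [← hsum, add_assoc, add_comm w s]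
  · rintro (hz | ⟨hz, hne⟩)
    · refine ⟨subset_coneN _ hz, ?_⟩
      rintro ⟨w, hw, rfl⟩
      exact hF.2 (S.add_mem hz hw)
    · refine ⟨hz.1.1, ?_⟩
      rintro ⟨w, hw, rfl⟩
      rcases eq_or_ne w 0 with rfl | hw0
      · exact hne (add_zero z).symm
      · exact hF.2 (hz.2 w hw hw0)

/-- If `S` is a `≺`-almost symmetric `C`-semigroup, then
(a) `Ω_≺ = S ∪ PF'_≺(S)`; (b) `Ω_≺ + S* = S*`; (c) `Ω_≺ ⊆ S − S*`; and
(d) `|PF(S)| = |Ω_≺ \ S| + 1`. -/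
theorem almostSym_omega {d : ℕ} (S : AddSubmonoid (Fin d → ℕ)) (hC : CSemigroup S)
    (prec : (Fin d → ℕ) → (Fin d → ℕ) → Prop) (hprec : IsTermOrder prec)
    (F : Fin d → ℕ) (hF : IsFrob (S : Set (Fin d → ℕ)) prec F)
    (hAS : AlmostSym (S : Set (Fin d → ℕ)) F) :
    omegaSet (S : Set (Fin d → ℕ)) F =
        (S : Set (Fin d → ℕ)) ∪ (pfSet (S : Set (Fin d → ℕ)) \ {F}) ∧
    {x | ∃ a ∈ omegaSet (S : Set (Fin d → ℕ)) F,
        ∃ b ∈ (S : Set (Fin d → ℕ)), b ≠ 0 ∧ x = a + b} =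
      {s ∈ (S : Set (Fin d → ℕ)) | s ≠ 0} ∧
    omegaSet (S : Set (Fin d → ℕ)) F ⊆
      {z ∈ coneN (S : Set (Fin d → ℕ)) |
        ∀ s ∈ (S : Set (Fin d → ℕ)), s ≠ 0 → z + s ∈ S} ∧
    (pfSet (S : Set (Fin d → ℕ))).ncard =
      (omegaSet (S : Set (Fin d → ℕ)) F \ (S : Set (Fin d → ℕ))).ncard + 1 := by
  have hΩ := hAS.omegaSet_eq hF.1 hC.2.2
  have hadd : ∀ z ∈ omegaSet (S : Set (Fin d → ℕ)) F,
      ∀ s ∈ (S : Set (Fin d → ℕ)), s ≠ 0 → z + s ∈ S := by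
    intro z hz s hs hs0
    rw [hΩ] at hz
    rcases hz with hz | hz
    · exact S.add_mem hz hs
    · exact hz.1.2 s hs hs0
  refine ⟨hΩ, ?_, fun z hz => ⟨hz.1, hadd z hz⟩, ?_⟩
  · ext x
    constructor
    · rintro ⟨a, ha, b, hb, hb0, rfl⟩
      exact ⟨hadd a ha b hb hb0, fun h => hb0 (add_eq_zero.mp h).2⟩
    · rintro ⟨hx, hx0⟩
      exact ⟨0, hΩ ▸ Or.inl S.zero_mem, x, hx, hx0, (zero_add x).symm⟩
  · have hdiff : omegaSet (S : Set (Fin d → ℕ)) F \ (S : Set (Fin d → ℕ)) =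
        pfSet (S : Set (Fin d → ℕ)) \ {F} := by
      rw [hΩ, Set.union_sdiff_left]
      exact sdiff_eq_left.mpr (Set.disjoint_left.mpr fun x hx => hx.1.1.2)
    rw [hdiff]
    exact (Set.ncard_sdiff_singleton_add_one (hAS.frob_mem_pfSet hF.1)
      (hC.2.2.subset fun x hx => hx.1)).symm
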